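/- For every f ∈ L¹(ℍⁿ) and every fixed z ∈ ℂⁿ, the normalized Strichartz Fourier transform vanishes at infinity on the Heisenberg fan: for every ε > 0 there exists R > 0 such that |f̃(a,z)| < ε for all a ∈ Ω with Euclidean norm |a| > R. -/

import Mathlib

open MeasureTheory Complex Real Filter

noncomputable section

/-- ℂⁿ with its Euclidean (Hilbert space) structure. -/
abbrev Cn (n : ℕ) := EuclideanSpace ℂ (Fin n)

instance (n : ℕ) : MeasurableSpace (Cn n) := borel _
instance (n : ℕ) : BorelSpace (Cn n) := ⟨rfl⟩
instance (n : ℕ) : InnerProductSpace ℝ (Cn n) := InnerProductSpace.rclikeToReal ℂ (Cn n)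

/-- The Heisenberg group ℍⁿ = ℂⁿ × ℝ (as a measure space with Lebesgue/Haar measure). -/
abbrev Hn (n : ℕ) := Cn n × ℝ

/-- Im (z · w̄) = Im (∑ⱼ zⱼ conj wⱼ). -/
def imZW {n : ℕ} (z w : Cn n) : ℝ := (∑ j, z j * (starRingEnd ℂ) (w j)).im

/-- The λ-twisted convolution F ∗_λ G (z) = ∫ F(z−w) G(w) e^{(i/2)λ Im(z·w̄)} dw. -/
def twConv (n : ℕ) (lam : ℝ) (F G : Cn n → ℂ) (z : Cn n) : ℂ :=
  ∫ w : Cn n, F (z - w) * G w * Complex.exp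
    (Complex.I / 2 * (lam : ℂ) * ((imZW z w : ℝ) : ℂ))

/-- The inverse Fourier transform in the central variable, f^λ(z) = ∫ e^{iλt} f(z,t) dt. -/
def fLam (n : ℕ) (f : Hn n → ℂ) (lam : ℝ) (z : Cn n) : ℂ :=
  ∫ t : ℝ, Complex.exp (Complex.I * (lam : ℂ) * (t : ℂ)) * f (z, t)

/-- The Laguerre polynomial of type m−1:
L_k^{m−1}(t) = ∑_{j=0}^k binom(k+m−1, k−j) (−t)^j / j!. -/
def lagPoly (m k : ℕ) (t : ℝ) : ℝ :=
  ∑ j ∈ Finset.range (k + 1), ((k + m - 1).choose (k - j) : ℝ) * (-t) ^ j / (Nat.factorial j)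

/-- The Laguerre function φ_{k,λ}^{m−1}(z) = L_k^{m−1}(|λ||z|²/2) e^{−|λ||z|²/4} on ℂ^m. -/
def lagFun (m k : ℕ) (lam : ℝ) (z : Cn m) : ℝ :=
  lagPoly m k (|lam| * ‖z‖ ^ 2 / 2) * Real.exp (-(|lam| * ‖z‖ ^ 2 / 4))

/-- The Strichartz Fourier transform f̂(a,z) = f^{−λ} ∗_{−λ} φ_{k,λ}(z)
at the point a = (λ, (2k+n)|λ|) of the ray R_k. -/
def stri (n : ℕ) (f : Hn n → ℂ) (k : ℕ) (lam : ℝ) (z : Cn n) : ℂ :=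
  twConv n (-lam) (fLam n f (-lam)) (fun w => ((lagFun n k lam w : ℝ) : ℂ)) z

/-- The normalizing constant k!(n−1)!/(k+n−1)!. -/
def normC (n k : ℕ) : ℝ :=
  (Nat.factorial k * Nat.factorial (n - 1) : ℝ) / (Nat.factorial (k + n - 1))

/-- The Bessel kernel J_{n−1}(s)/s^{n−1}, extended by its limiting value
1/(2^{n−1}(n−1)!) at s = 0, given by its power series. -/
def besselKer (n : ℕ) (s : ℝ) : ℝ :=
  ∑' m : ℕ, (-1 : ℝ) ^ m / (Nat.factorial m * Nat.factorial (m + n - 1)) *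
    s ^ (2 * m) / 2 ^ (2 * m + n - 1)

/-- The Strichartz Fourier transform f̂((0,τ),z) on the limiting ray R_∞. -/
def striLim (n : ℕ) (f : Hn n → ℂ) (z : Cn n) (τ : ℝ) : ℂ :=
  ((Nat.factorial (n - 1) * 2 ^ (n - 1) : ℝ) : ℂ) *
    ∫ w : Cn n, fLam n f 0 (z - w) * ((besselKer n (Real.sqrt τ * ‖w‖) : ℝ) : ℂ)

/-- The Heisenberg fan Ω ⊆ ℝ²: union of the rays R_k, k ∈ ℕ, and the limiting ray R_∞. -/
def fan (n : ℕ) : Set (ℝ × ℝ) :=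
  {a | (∃ k : ℕ, a.1 ≠ 0 ∧ a.2 = (2 * k + n) * |a.1|) ∨ (a.1 = 0 ∧ 0 ≤ a.2)}

open scoped Classical in
/-- The index k of the ray R_k through a point of the fan (junk value otherwise). -/
def fanK (n : ℕ) (a : ℝ × ℝ) : ℕ :=
  if h : ∃ k : ℕ, a.2 = (2 * k + n) * |a.1| then h.choose else 0

/-- The normalized Strichartz Fourier transform f̃(a,z), as a function of a ∈ Ω. -/
def striNorm (n : ℕ) (f : Hn n → ℂ) (z : Cn n) (a : ℝ × ℝ) : ℂ :=
  if a.1 = 0 then striLim n f z a.2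
  else ((normC n (fanK n a) : ℝ) : ℂ) * stri n f (fanK n a) a.1 z

/-- The Plancherel measure ν on the Heisenberg fan:
∫ φ dν = (2π)^{−2n−1} ∫_ℝ (∑_k φ(λ,(2k+n)|λ|)) |λ|^{2n} dλ. -/
def fanMeasure (n : ℕ) : Measure (ℝ × ℝ) :=
  (ENNReal.ofReal ((2 * π) ^ (2 * n + 1)))⁻¹ •
    Measure.sum (fun k : ℕ =>
      Measure.map (fun lam : ℝ => (lam, (2 * k + n) * |lam|))
        (volume.withDensity fun lam => ENNReal.ofReal (|lam| ^ (2 * n))))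

/-- A function on ℍⁿ is radial if it is invariant under the action of the unitary group U(n). -/
def IsRadial (n : ℕ) (g : Hn n → ℂ) : Prop :=
  ∀ (U : Cn n ≃ₗᵢ[ℂ] Cn n) (x : Hn n), g (U x.1, x.2) = g x

/-- The k-th Laguerre coefficient R_k(λ, f) = (k!(n−1)!/(k+n−1)!) ∫ f^λ(w) φ_{k,λ}(w) dw. -/
def lagCoef (n : ℕ) (k : ℕ) (lam : ℝ) (f : Hn n → ℂ) : ℂ :=
  ((normC n k : ℝ) : ℂ) * ∫ w : Cn n, fLam n f lam w * ((lagFun n k lam w : ℝ) : ℂ)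

/-- The Gelfand (spherical Fourier) transform of a radial function on ℍ^m, evaluated at
(λ, (2j+m)|λ|). -/
def gelfand (m : ℕ) (h : Hn m → ℂ) (lam : ℝ) (j : ℕ) : ℂ :=
  ((normC m j : ℝ) : ℂ) *
    ∫ x : Hn m, h x * Complex.exp (Complex.I * (lam : ℂ) * (x.2 : ℂ)) *
      ((lagFun m j lam x.1 : ℝ) : ℂ)

/-- The group convolution on ℍⁿ: f∗g(x) = ∫ f(x·y⁻¹) g(y) dy. -/
def hConv (n : ℕ) (f g : Hn n → ℂ) (x : Hn n) : ℂ :=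
  ∫ y : Hn n, f (x.1 - y.1, x.2 - y.2 - imZW x.1 y.1 / 2) * g y

/-- P is a bigraded solid harmonic of degree (p,q) on ℂⁿ: P(z) = ∑_{|α|=p,|β|=q} c_{αβ} z^α z̄^β,
harmonic as a function on ℝ^{2n} (the harmonicity Δ P = 0 is expressed by the equivalent
algebraic condition on the coefficients). -/
def IsBigradedSolidHarmonic (n p q : ℕ) (P : Cn n → ℂ) : Prop :=
  ∃ c : (Fin n → ℕ) → (Fin n → ℕ) → ℂ,
    (∀ z : Cn n, P z =
      ∑ α ∈ Finset.Nat.antidiagonalTuple n p, ∑ β ∈ Finset.Nat.antidiagonalTuple n q,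
        c α β * (∏ j, z j ^ α j) * ∏ j, (starRingEnd ℂ) (z j) ^ β j) ∧
    (∀ γ δ : Fin n → ℕ,
      ∑ j : Fin n, (((γ j + 1) * (δ j + 1) : ℕ) : ℂ) *
        c (Function.update γ j (γ j + 1)) (Function.update δ j (δ j + 1)) = 0)

/-- The physicists' Hermite polynomial H_m(x) = (−1)^m e^{x²} (d/dx)^m e^{−x²}. -/
def physHermite (m : ℕ) (x : ℝ) : ℝ :=
  (-1 : ℝ) ^ m * Real.exp (x ^ 2) * iteratedDeriv m (fun y => Real.exp (-(y ^ 2))) x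

/-- The normalized Hermite function h_m(x) = (2^m m! √π)^{−1/2} H_m(x) e^{−x²/2}. -/
def hermiteFun (m : ℕ) (x : ℝ) : ℝ :=
  (Real.sqrt (2 ^ m * (Nat.factorial m) * Real.sqrt π))⁻¹ * physHermite m x *
    Real.exp (-(x ^ 2) / 2)

/-- The scaled Hermite function Φ_α^λ(x) = |λ|^{n/4} ∏ⱼ h_{αⱼ}(√|λ| xⱼ). -/
def scaledHermite (n : ℕ) (lam : ℝ) (α : Fin n → ℕ) (x : Fin n → ℝ) : ℝ :=
  |lam| ^ ((n : ℝ) / 4) * ∏ j, hermiteFun (α j) (Real.sqrt |lam| * x j)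

/-- The Schrödinger representation: π_λ(z,t)φ(ξ) = e^{iλt} e^{iλ(x·ξ+(1/2)x·y)} φ(ξ+y),
z = x+iy. -/
def schrodinger (n : ℕ) (lam : ℝ) (zt : Hn n) (φ : (Fin n → ℝ) → ℂ) (ξ : Fin n → ℝ) : ℂ :=
  Complex.exp (Complex.I * (lam : ℂ) * (zt.2 : ℂ)) *
    Complex.exp (Complex.I * (lam : ℂ) *
      (((∑ j, (zt.1 j).re * ξ j) + (∑ j, (zt.1 j).re * (zt.1 j).im) / 2 : ℝ) : ℂ)) *
    φ (fun j => ξ j + (zt.1 j).im)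

/-- The group Fourier transform f̂(λ)φ = ∫ f(z,t) π_λ(z,t)φ dz dt. -/
def groupFT (n : ℕ) (f : Hn n → ℂ) (lam : ℝ) (φ : (Fin n → ℝ) → ℂ) (ξ : Fin n → ℝ) : ℂ :=
  ∫ x : Hn n, f x * schrodinger n lam x φ ξ


lemma lagPoly_zero (m : ℕ) (x : ℝ) : lagPoly m 0 x = 1 := by
  simp [lagPoly]

lemma lagPoly_one_at_zero (k : ℕ) : lagPoly 1 k 0 = 1 := by
  rw [lagPoly, Finset.sum_eq_single 0] <;> simp +contextual

/-- Pascal's rule for Laguerre polynomials: `L_{k+1}^{a+1} = L_k^{a+1} + L_{k+1}^a`. -/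
lemma lagPoly_succ_succ (a k : ℕ) (x : ℝ) :
    lagPoly (a + 2) (k + 1) x = lagPoly (a + 2) k x + lagPoly (a + 1) (k + 1) x := by
  simp only [lagPoly]
  rw [Finset.sum_range_succ _ (k + 1), Finset.sum_range_succ _ (k + 1),
    ← add_assoc (Finset.sum _ _), ← Finset.sum_add_distrib]
  congr 1
  · refine Finset.sum_congr rfl fun j hj => ?_
    have hj' : j ≤ k := by simpa [Nat.lt_succ_iff] using hj
    have h : (k + 1 + (a + 2) - 1).choose (k + 1 - j) =
        (k + (a + 2) - 1).choose (k - j) + (k + 1 + (a + 1) - 1).choose (k + 1 - j) := by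
      rw [show k + 1 + (a + 2) - 1 = (k + a + 1) + 1 by omega, show k + 1 - j = (k - j) + 1 by omega,
        show k + (a + 2) - 1 = k + a + 1 by omega, show k + 1 + (a + 1) - 1 = k + a + 1 by omega,
        Nat.choose_succ_succ]
    rw [h]
    push_cast
    ring
  · simp

/-- `(L_{k+1}^0)' = -L_k^1`. -/
lemma hasDerivAt_lagPoly_one (k : ℕ) (x : ℝ) :
    HasDerivAt (lagPoly 1 (k + 1)) (-lagPoly 2 k x) x := by
  have h : HasDerivAt (fun t : ℝ => ∑ j ∈ Finset.range (k + 1 + 1),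
      ((k + 1 + 1 - 1).choose (k + 1 - j) : ℝ) * (-t) ^ j / (Nat.factorial j))
      (∑ j ∈ Finset.range (k + 1 + 1), ((k + 1 + 1 - 1).choose (k + 1 - j) : ℝ) *
        ((j : ℝ) * (-x) ^ (j - 1) * (-1)) / (Nat.factorial j)) x := by
    refine HasDerivAt.fun_sum fun j _ => ?_
    exact (((hasDerivAt_id x).neg.pow j).const_mul _).div_const _
  refine h.congr_deriv ?_
  rw [Finset.sum_range_succ', lagPoly, ← Finset.sum_neg_distrib]
  simp only [Nat.cast_zero, zero_mul, mul_zero, zero_div, add_zero]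
  refine Finset.sum_congr rfl fun j _ => ?_
  rw [show k + 1 + 1 - 1 = k + 2 - 1 by omega, show k + 1 - (j + 1) = k - j by omega,
    Nat.factorial_succ]
  have : (j.factorial : ℝ) ≠ 0 := by positivity
  push_cast
  have : (j + 1 : ℝ) ≠ 0 := by positivity
  field_simp

/-- `(k+1) (L_{k+1}^0 - L_k^0) = -x L_k^1`. -/
lemma lagPoly_one_sub (k : ℕ) (x : ℝ) :
    (k + 1 : ℝ) * (lagPoly 1 (k + 1) x - lagPoly 1 k x) = -(x * lagPoly 2 k x) := by
  have h1 : lagPoly 1 (k + 1) x = ∑ j ∈ Finset.range k,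
      ((k + 1).choose (k + 1 - (j + 1)) : ℝ) * (-x) ^ (j + 1) / (Nat.factorial (j + 1)) +
      (-x) ^ (k + 1) / (Nat.factorial (k + 1)) + 1 := by
    rw [lagPoly, Finset.sum_range_succ', Finset.sum_range_succ]
    simp
  have h2 : lagPoly 1 k x = ∑ j ∈ Finset.range k,
      (k.choose (k - (j + 1)) : ℝ) * (-x) ^ (j + 1) / (Nat.factorial (j + 1)) + 1 := by
    rw [lagPoly, Finset.sum_range_succ']
    simp
  have h3 : lagPoly 2 k x = ∑ j ∈ Finset.range k,
      ((k + 1).choose (k - j) : ℝ) * (-x) ^ j / (Nat.factorial j) +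
      (-x) ^ k / (Nat.factorial k) := by
    rw [lagPoly, Finset.sum_range_succ]
    simp
  have h : ∀ j ∈ Finset.range k,
      (k + 1 : ℝ) * (((k + 1).choose (k + 1 - (j + 1)) : ℝ) * (-x) ^ (j + 1) /
        (Nat.factorial (j + 1)) - (k.choose (k - (j + 1)) : ℝ) * (-x) ^ (j + 1) /
        (Nat.factorial (j + 1))) =
      -(x * (((k + 1).choose (k - j) : ℝ) * (-x) ^ j / (Nat.factorial j))) := by
    intro j hj
    have hj' : j < k := by simpa using hj
    obtain ⟨i, rfl⟩ : ∃ i, k = j + 1 + i := ⟨k - (j + 1), by omega⟩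
    have e1 : ((j + 1 + i + 1).choose (i + 1) : ℝ) =
        (j + 1 + i).choose i + (j + 1 + i).choose (i + 1) := by
      exact_mod_cast Nat.choose_succ_succ _ _
    have e2 : ((j + 1 + i + 1 : ℕ) : ℝ) * (j + 1 + i).choose (i + 1) =
        (j + 1 + i + 1).choose (i + 1) * (j + 1 : ℝ) := by
      have := Nat.add_one_mul_choose_eq (j + 1 + i) j
      rw [show (j + 1 + i).choose j = (j + 1 + i).choose (i + 1) from
        Nat.choose_symm_of_eq_add (by omega),
        show (j + 1 + i + 1).choose (j + 1) = (j + 1 + i + 1).choose (i + 1) from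
        Nat.choose_symm_of_eq_add (by omega)] at this
      exact_mod_cast this
    rw [show j + 1 + i + 1 - (j + 1) = i + 1 by omega,
      show j + 1 + i - (j + 1) = i by omega,
      show j + 1 + i - j = i + 1 by omega, Nat.factorial_succ]
    have : (j.factorial : ℝ) ≠ 0 := by positivity
    have h3 : (j + 1 : ℝ) ≠ 0 := by positivity
    push_cast at e2 ⊢
    field_simp
    rw [pow_succ]
    linear_combination (-x) ^ j * x * (-e2 - ((j : ℝ) + 1 + i + 1) * e1)
  have hs := Finset.sum_congr rfl h
  rw [← Finset.mul_sum, Finset.sum_sub_distrib, Finset.sum_neg_distrib, ← Finset.mul_sum] at hs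
  have hl : (k + 1 : ℝ) * ((-x) ^ (k + 1) / (Nat.factorial (k + 1))) =
      -(x * ((-x) ^ k / (Nat.factorial k))) := by
    rw [Nat.factorial_succ]
    have : (k.factorial : ℝ) ≠ 0 := by positivity
    have : (k + 1 : ℝ) ≠ 0 := by positivity
    push_cast
    field_simp
    ring
  rw [h1, h2, h3]
  linear_combination hs + hl

/-- The exponentially weighted Laguerre polynomial `L_k^{m-1}(x) e^{-x/2}`. -/
def lagExp (m k : ℕ) (x : ℝ) : ℝ := lagPoly m k x * Real.exp (-(x / 2))

lemma lagExp_succ_succ (a k : ℕ) (x : ℝ) :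
    lagExp (a + 2) (k + 1) x = lagExp (a + 2) k x + lagExp (a + 1) (k + 1) x := by
  simp only [lagExp, lagPoly_succ_succ]
  ring

lemma lagExp_one_sub (k : ℕ) (x : ℝ) :
    x * lagExp 2 k x = (k + 1 : ℝ) * (lagExp 1 k x - lagExp 1 (k + 1) x) := by
  simp only [lagExp]
  linear_combination Real.exp (-(x / 2)) * lagPoly_one_sub k x

lemma lagExp_one_at_zero (k : ℕ) : lagExp 1 k 0 = 1 := by
  simp [lagExp, lagPoly_one_at_zero]

lemma continuous_lagExp (m k : ℕ) : Continuous (lagExp m k) := by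
  unfold lagExp lagPoly
  fun_prop

lemma differentiable_lagExp (m k : ℕ) : Differentiable ℝ (lagExp m k) := by
  unfold lagExp lagPoly
  fun_prop

lemma hasDerivAt_exp_neg_half (x : ℝ) :
    HasDerivAt (fun t : ℝ => Real.exp (-(t / 2))) (-(Real.exp (-(x / 2)) / 2)) x := by
  have h := (((hasDerivAt_id x).div_const 2).neg).exp
  refine h.congr_deriv ?_
  simp only [id, Pi.neg_apply]
  ring

lemma hasDerivAt_lagExp_one_succ (k : ℕ) (x : ℝ) :
    HasDerivAt (lagExp 1 (k + 1)) (-(lagExp 1 (k + 1) x / 2) - lagExp 2 k x) x := by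
  refine ((hasDerivAt_lagPoly_one k x).mul (hasDerivAt_exp_neg_half x)).congr_deriv ?_
  simp only [lagExp]
  ring

lemma hasDerivAt_lagExp_one (k : ℕ) (x : ℝ) :
    HasDerivAt (lagExp 1 k) (lagExp 1 k x / 2 - lagExp 2 k x) x := by
  cases k with
  | zero =>
    have h : lagExp 1 0 = fun t => Real.exp (-(t / 2)) := by
      ext t; simp [lagExp, lagPoly_zero]
    rw [h]
    refine (hasDerivAt_exp_neg_half x).congr_deriv ?_
    simp only [lagExp, lagPoly_zero]
    ring
  | succ k =>
    refine (hasDerivAt_lagExp_one_succ k x).congr_deriv ?_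
    rw [lagExp_succ_succ]
    ring

lemma mul_deriv_lagExp_two (k : ℕ) (x : ℝ) :
    x * deriv (lagExp 2 k) x =
      (k + 1 : ℝ) * (lagExp 1 (k + 1) x + lagExp 1 k x) / 2 - lagExp 2 k x := by
  have h1 : HasDerivAt (fun t => t * lagExp 2 k t)
      (1 * lagExp 2 k x + x * deriv (lagExp 2 k) x) x :=
    (hasDerivAt_id x).mul (differentiable_lagExp 2 k x).hasDerivAt
  have h2 := ((hasDerivAt_lagExp_one k x).sub
    (hasDerivAt_lagExp_one_succ k x)).const_mul (k + 1 : ℝ)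
  have h := h1.unique (h2.congr_of_eventuallyEq (.of_forall fun t => lagExp_one_sub k t))
  linear_combination h

/-- The monotone quadratic form controlling two consecutive Laguerre functions. -/
lemma lagExp_form_le_one (k : ℕ) {x : ℝ} (hx : 0 ≤ x) :
    x * lagExp 2 k x ^ 2 / (k + 1) + lagExp 1 (k + 1) x * lagExp 1 k x ≤ 1 := by
  have hk : (k + 1 : ℝ) ≠ 0 := by positivity
  have hd : ∀ t : ℝ, HasDerivAt
      (fun t => t * lagExp 2 k t ^ 2 / (k + 1) + lagExp 1 (k + 1) t * lagExp 1 k t)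
      (-(lagExp 2 k t ^ 2 / (k + 1))) t := by
    intro t
    refine ((((hasDerivAt_id t).mul
      ((differentiable_lagExp 2 k t).hasDerivAt.pow 2)).div_const (k + 1 : ℝ)).add
      ((hasDerivAt_lagExp_one_succ k t).mul (hasDerivAt_lagExp_one k t))).congr_deriv ?_
    have h := mul_deriv_lagExp_two k t
    simp only [id, Pi.pow_apply]
    field_simp
    linear_combination 4 * lagExp 2 k t * h
  have ha := antitone_of_hasDerivAt_nonpos hd (fun t => by
    simp only [Pi.zero_apply, Left.neg_nonpos_iff]; positivity)
  simpa [lagExp_one_at_zero] using ha hx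

lemma sum_sq_lagExp_sub_le_one (k : ℕ) {x : ℝ} (hx : 0 ≤ x) :
    ∑ j ∈ Finset.range k, (lagExp 1 (j + 1) x - lagExp 1 j x) ^ 2 ≤ 1 := by
  have hd : ∀ t : ℝ, HasDerivAt
      (fun t => Real.exp (-t) + ∑ j ∈ Finset.range k, (lagExp 1 (j + 1) t - lagExp 1 j t) ^ 2)
      (-(lagExp 1 k t ^ 2)) t := by
    intro t
    induction k with
    | zero =>
      simp only [Finset.range_zero, Finset.sum_empty, add_zero, lagExp, lagPoly_zero]
      refine (hasDerivAt_id t).neg.exp.congr_deriv ?_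
      simp only [id, Pi.neg_apply]
      rw [one_mul, ← Real.exp_nat_mul]
      ring_nf
    | succ k ih =>
      simp only [Finset.sum_range_succ, ← add_assoc]
      refine (ih.add (((hasDerivAt_lagExp_one_succ k t).sub
        (hasDerivAt_lagExp_one k t)).pow 2)).congr_deriv ?_
      simp only [Pi.sub_apply]
      ring
  have ha := antitone_of_hasDerivAt_nonpos hd (fun t => by
    simp only [Pi.zero_apply, Left.neg_nonpos_iff]; positivity)
  have h := ha hx
  simp only [lagExp_one_at_zero, sub_self, neg_zero, Real.exp_zero] at h
  have := Real.exp_pos (-x)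
  simp at h
  linarith

lemma abs_lagExp_one_le (k : ℕ) {x : ℝ} (hx : 0 ≤ x) : |lagExp 1 k x| ≤ 2 := by
  cases k with
  | zero =>
    have : Real.exp (-(x / 2)) ≤ 1 := Real.exp_le_one_iff.2 (by linarith)
    simp only [lagExp, lagPoly_zero, one_mul, Real.abs_exp]
    linarith
  | succ k =>
    have h1 := lagExp_form_le_one k hx
    have h2 : (lagExp 1 (k + 1) x - lagExp 1 k x) ^ 2 ≤ 1 := by
      refine le_trans ?_ (sum_sq_lagExp_sub_le_one (k + 1) hx)
      rw [Finset.sum_range_succ]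
      exact le_add_of_nonneg_left (Finset.sum_nonneg fun _ _ => sq_nonneg _)
    have h3 : 0 ≤ x * lagExp 2 k x ^ 2 / (k + 1) := by positivity
    rw [abs_le]
    constructor <;> nlinarith [sq_nonneg (lagExp 1 (k + 1) x), sq_nonneg (lagExp 1 k x)]

lemma mul_sq_lagExp_two_le (k : ℕ) {x : ℝ} (hx : 0 ≤ x) :
    x * lagExp 2 k x ^ 2 ≤ 5 * (k + 1) := by
  have h1 := lagExp_form_le_one k hx
  have hu := abs_le.1 (abs_lagExp_one_le (k + 1) hx)
  have hv := abs_le.1 (abs_lagExp_one_le k hx)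
  have h2 : x * lagExp 2 k x ^ 2 / (k + 1) ≤ 5 := by
    nlinarith [mul_nonneg (sub_nonneg.2 hu.1) (sub_nonneg.2 hv.1)]
  rwa [div_le_iff₀ (by positivity)] at h2

lemma abs_lagExp_le (a k : ℕ) {x : ℝ} (hx : 0 ≤ x) :
    |lagExp (a + 1) k x| ≤ 2 * (k + a).choose a := by
  induction a generalizing k with
  | zero => simpa using abs_lagExp_one_le k hx
  | succ a iha =>
    induction k with
    | zero =>
      have := abs_lagExp_one_le 0 hx
      simpa [lagExp, lagPoly_zero] using this
    | succ k ihk =>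
      rw [lagExp_succ_succ]
      refine (abs_add_le _ _).trans ?_
      have h := iha (k + 1)
      have e : ((k + 1 + (a + 1)).choose (a + 1) : ℝ) =
          (k + (a + 1)).choose (a + 1) + (k + 1 + a).choose a := by
        rw [show k + 1 + (a + 1) = (k + 1 + a) + 1 by ring, Nat.choose_succ_succ,
          show k + (a + 1) = k + 1 + a by ring]
        push_cast
        ring
      rw [e]
      linarith

lemma sqrt_mul_abs_lagExp_le (a k : ℕ) {x : ℝ} (hx : 0 ≤ x) :
    √x * |lagExp (a + 2) k x| ≤ √5 * √(k + 1) * (k + a).choose a := by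
  induction a generalizing k with
  | zero =>
    have h := Real.sqrt_le_sqrt (mul_sq_lagExp_two_le k hx)
    rw [Real.sqrt_mul hx, Real.sqrt_sq_eq_abs, Real.sqrt_mul (by norm_num)] at h
    simpa using h
  | succ a iha =>
    induction k with
    | zero =>
      have := iha 0
      simpa [lagExp, lagPoly_zero] using this
    | succ k ihk =>
      rw [lagExp_succ_succ]
      have h0 : √x * |lagExp (a + 1 + 2) k x + lagExp (a + 1 + 1) (k + 1) x| ≤
          √x * |lagExp (a + 1 + 2) k x| + √x * |lagExp (a + 1 + 1) (k + 1) x| := by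
        rw [← mul_add]
        exact mul_le_mul_of_nonneg_left (abs_add_le _ _) (Real.sqrt_nonneg _)
      refine h0.trans ?_
      have h := iha (k + 1)
      have e : ((k + 1 + (a + 1)).choose (a + 1) : ℝ) =
          (k + (a + 1)).choose (a + 1) + (k + 1 + a).choose a := by
        rw [show k + 1 + (a + 1) = (k + 1 + a) + 1 by ring, Nat.choose_succ_succ,
          show k + (a + 1) = k + 1 + a by ring]
        push_cast
        ring
      have hs : √((k : ℝ) + 1) ≤ √((k + 1 : ℕ) + 1 : ℝ) := by
        apply Real.sqrt_le_sqrt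
        push_cast
        linarith
      have hm : √5 * √((k : ℝ) + 1) * ((k + (a + 1)).choose (a + 1) : ℝ) ≤
          √5 * √((k + 1 : ℕ) + 1 : ℝ) * ((k + (a + 1)).choose (a + 1) : ℝ) := by
        gcongr
      rw [e]
      linarith

/-- A quadratic form in the Laguerre function `lagExp 1 (k + 1)` and its derivative which decays
along the half-line (up to a square root factor). -/
def lagEnergy (k : ℕ) (x : ℝ) : ℝ :=
  (x * lagExp 1 (k + 1) x + 2 * x * lagExp 2 k x) ^ 2 +
    x * (4 * k + 6 - x) * lagExp 1 (k + 1) x ^ 2 -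
    lagExp 1 (k + 1) x * (x * lagExp 1 (k + 1) x + 2 * x * lagExp 2 k x) +
    lagExp 1 (k + 1) x ^ 2 / 2

lemma hasDerivAt_lagEnergy (k : ℕ) {x : ℝ} (hx : x ≠ 0) :
    HasDerivAt (lagEnergy k)
      (lagEnergy k x / (2 * x) - (x + 1 / (4 * x)) * lagExp 1 (k + 1) x ^ 2) x := by
  have hu := hasDerivAt_lagExp_one_succ k x
  have hg := (differentiable_lagExp 2 k x).hasDerivAt
  have hid := hasDerivAt_id x
  have hz := (hid.mul hu).add ((hid.const_mul 2).mul hg)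
  refine ((((hz.pow 2).add ((hid.mul (hid.const_sub (4 * k + 6 : ℝ))).mul (hu.pow 2))).sub
    (hu.mul hz)).add ((hu.pow 2).div_const 2)).congr_deriv ?_
  have h := mul_deriv_lagExp_two k x
  have h' := lagExp_one_sub k x
  simp only [id, lagEnergy, Pi.mul_apply, Pi.add_apply, Pi.pow_apply]
  set u := lagExp 1 (k + 1) x
  set g := lagExp 2 k x
  have e1 : deriv (lagExp 2 k) x = ((k + 1 : ℝ) * (u + lagExp 1 k x) / 2 - g) / x := by
    field_simp
    linear_combination 2 * h
  have e2 : lagExp 1 k x = u + x * g / (k + 1) := by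
    field_simp
    linear_combination -h'
  rw [e1, e2]
  field_simp
  ring

lemma mul_sq_le_lagEnergy (k : ℕ) (x : ℝ) :
    x * (4 * k + 6 - x) * lagExp 1 (k + 1) x ^ 2 ≤ lagEnergy k x := by
  unfold lagEnergy
  nlinarith [sq_nonneg (x * lagExp 1 (k + 1) x + 2 * x * lagExp 2 k x - lagExp 1 (k + 1) x / 2),
    sq_nonneg (lagExp 1 (k + 1) x)]

lemma antitoneOn_sq_lagEnergy_div (k : ℕ) :
    AntitoneOn (fun x => lagEnergy k x ^ 2 / x) (Set.Ioc 0 (2 * k + 3)) := by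
  have hd : ∀ x ∈ Set.Ioc (0 : ℝ) (2 * k + 3), HasDerivAt (fun x => lagEnergy k x ^ 2 / x)
      (-(2 * lagEnergy k x / x * ((x + 1 / (4 * x)) * lagExp 1 (k + 1) x ^ 2))) x := by
    intro x hx
    have hx0 := hx.1.ne'
    refine (((hasDerivAt_lagEnergy k hx0).pow 2).div (hasDerivAt_id x) hx0).congr_deriv ?_
    simp only [id, Pi.pow_apply]
    field_simp
    ring
  refine antitoneOn_of_deriv_nonpos (convex_Ioc _ _)
    (fun x hx => (hd x hx).continuousAt.continuousWithinAt)
    (fun x hx => (hd x (interior_subset hx)).differentiableAt.differentiableWithinAt)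
    (fun x hx => ?_)
  have hx' := interior_subset hx
  rw [(hd x hx').deriv]
  have hx0 := hx'.1
  have hE : 0 ≤ lagEnergy k x := by
    refine le_trans ?_ (mul_sq_le_lagEnergy k x)
    have : 0 ≤ 4 * k + 6 - x := by linarith [hx'.2]
    positivity
  rw [neg_nonpos]
  positivity

lemma lagEnergy_initial_le (k : ℕ) : lagEnergy k (1 / (k + 2)) ≤ 100 := by
  have hk : (0 : ℝ) < k + 2 := by positivity
  set x : ℝ := 1 / (k + 2) with hxdef
  have hx : 0 ≤ x := by positivity
  have hxk : x * (k + 2) = 1 := by rw [hxdef]; field_simp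
  have hx1 : x ≤ 1 := by nlinarith
  have hu := abs_lagExp_one_le (k + 1) hx
  have hg : |lagExp 2 k x| ≤ 2 * (k + 1) := by
    simpa using abs_lagExp_le 1 k hx
  have hz : |x * lagExp 1 (k + 1) x + 2 * x * lagExp 2 k x| ≤ 6 := by
    refine (abs_add_le _ _).trans ?_
    rw [abs_mul, abs_mul, abs_mul, abs_of_nonneg hx, abs_two]
    nlinarith [mul_le_mul_of_nonneg_left hu hx, mul_le_mul_of_nonneg_left hg hx]
  have hu2 : lagExp 1 (k + 1) x ^ 2 ≤ 4 := by
    rw [← sq_abs]; nlinarith [abs_nonneg (lagExp 1 (k + 1) x)]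
  have hz2 : (x * lagExp 1 (k + 1) x + 2 * x * lagExp 2 k x) ^ 2 ≤ 36 := by
    rw [← sq_abs]; nlinarith [abs_nonneg (x * lagExp 1 (k + 1) x + 2 * x * lagExp 2 k x)]
  have huz : -(lagExp 1 (k + 1) x * (x * lagExp 1 (k + 1) x + 2 * x * lagExp 2 k x)) ≤ 12 := by
    refine (neg_le_abs _).trans ?_
    rw [abs_mul]
    nlinarith [abs_nonneg (lagExp 1 (k + 1) x),
      abs_nonneg (x * lagExp 1 (k + 1) x + 2 * x * lagExp 2 k x)]
  have hm : x * (4 * k + 6 - x) * lagExp 1 (k + 1) x ^ 2 ≤ 4 * 4 := by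
    have h1 : x * (4 * k + 6 - x) ≤ 4 := by nlinarith
    nlinarith [sq_nonneg (lagExp 1 (k + 1) x)]
  unfold lagEnergy
  linarith

/-- Decay of the Laguerre functions of type `0` in the oscillatory region. -/
lemma lagExp_one_pow_four_mul_le (k : ℕ) {x : ℝ} (hx : 0 ≤ x) (hxk : x ≤ k + 1) :
    lagExp 1 k x ^ 4 * ((k + 1) * x) ≤ 10000 := by
  have h16 : lagExp 1 k x ^ 4 ≤ 16 := by
    have h := pow_le_pow_left₀ (abs_nonneg _) (abs_lagExp_one_le k hx) 4
    rw [pow_abs, abs_of_nonneg (by positivity)] at h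
    linarith
  by_cases hs : (k + 1) * x ≤ 1
  · have : 0 ≤ lagExp 1 k x ^ 4 := by positivity
    have : 0 ≤ (k + 1) * x := by positivity
    nlinarith
  · cases k with
    | zero => simp at hs hxk; linarith
    | succ k =>
      push_cast at hs hxk ⊢
      have hk : (0 : ℝ) < k + 2 := by positivity
      have hx0 : 1 / (k + 2) ≤ x := by
        rw [div_le_iff₀ hk]; linarith
      have hpos : (0 : ℝ) < 1 / (k + 2) := by positivity
      have hxpos : 0 < x := hpos.trans_le hx0
      have ha := antitoneOn_sq_lagEnergy_div k (a := 1 / (k + 2)) (b := x)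
        ⟨hpos, hx0.trans (by linarith)⟩ ⟨hxpos, by linarith⟩ hx0
      simp only at ha
      have hE0 : 0 ≤ lagEnergy k (1 / (k + 2)) := by
        refine le_trans ?_ (mul_sq_le_lagEnergy k _)
        have : 0 ≤ 4 * k + 6 - 1 / ((k : ℝ) + 2) := by linarith
        positivity
      have hi : lagEnergy k (1 / (k + 2)) ^ 2 / (1 / (k + 2)) ≤ 10000 * (k + 2) := by
        rw [div_div_eq_mul_div, div_one]
        have := lagEnergy_initial_le k
        gcongr
        nlinarith
      have hl : x * (k + 2) * lagExp 1 (k + 1) x ^ 2 ≤ lagEnergy k x := by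
        refine le_trans ?_ (mul_sq_le_lagEnergy k x)
        have : (k : ℝ) + 2 ≤ 4 * k + 6 - x := by linarith
        gcongr
      have hl2 : (x * (k + 2) * lagExp 1 (k + 1) x ^ 2) ^ 2 / x ≤ 10000 * (k + 2) := by
        refine le_trans ?_ (ha.trans hi)
        gcongr
      have e : (x * (k + 2) * lagExp 1 (k + 1) x ^ 2) ^ 2 / x =
          (k + 2) * (lagExp 1 (k + 1) x ^ 4 * ((k + 2) * x)) := by
        field_simp
      rw [e, mul_comm (10000 : ℝ)] at hl2
      have := le_of_mul_le_mul_left hl2 hk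
      rw [show (k : ℝ) + 1 + 1 = k + 2 by ring]
      exact this

/-- The normalized Laguerre function `k!(m-1)!/(k+m-1)! L_k^{m-1}(x) e^{-x/2}`. -/
def normLag (m k : ℕ) (x : ℝ) : ℝ := normC m k * lagExp m k x

lemma normC_succ (a k : ℕ) : normC (a + 1) k = ((k + a).choose a : ℝ)⁻¹ := by
  rw [normC, ← Nat.choose_symm_add, Nat.cast_add_choose ℝ, inv_div]
  simp

lemma abs_normLag_le {m : ℕ} (hm : 1 ≤ m) (k : ℕ) {x : ℝ} (hx : 0 ≤ x) :
    |normLag m k x| ≤ 2 := by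
  obtain ⟨a, rfl⟩ := Nat.exists_eq_add_of_le' hm
  have hc : (0 : ℝ) < (k + a).choose a := by exact_mod_cast Nat.choose_pos (by omega)
  rw [normLag, normC_succ, abs_mul, abs_inv, abs_of_pos hc, inv_mul_le_iff₀ hc]
  linarith [abs_lagExp_le a k hx]

lemma normLag_pow_four_mul_le {m : ℕ} (hm : 1 ≤ m) (k : ℕ) {x : ℝ} (hx : 0 ≤ x)
    (hxk : x ≤ k + 1) : normLag m k x ^ 4 * ((k + 1) * x) ≤ 10000 * m ^ 2 := by
  obtain ⟨a, rfl⟩ := Nat.exists_eq_add_of_le' hm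
  cases a with
  | zero => simpa [normLag, normC_succ] using lagExp_one_pow_four_mul_le k hx hxk
  | succ a =>
    have h2 := abs_normLag_le hm k hx
    have hc : (0 : ℝ) < (k + (a + 1)).choose (a + 1) := by
      exact_mod_cast Nat.choose_pos (by omega)
    have hb : (k + 1 : ℝ) * (k + a).choose a ≤ (a + 1) * (k + (a + 1)).choose (a + 1) := by
      have h := Nat.add_one_mul_choose_eq (k + a) a
      have h' : (k + 1) * (k + a).choose a ≤ (a + 1) * (k + (a + 1)).choose (a + 1) := by
        rw [show k + (a + 1) = k + a + 1 by ring, mul_comm (a + 1), ← h]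
        gcongr
        omega
      exact_mod_cast h'
    have hs := sqrt_mul_abs_lagExp_le a k hx
    have hk : (0 : ℝ) < k + 1 := by positivity
    have h5 : x * lagExp (a + 1 + 1) k x ^ 2 ≤ 5 * (k + 1) * ((k + a).choose a : ℝ) ^ 2 := by
      have := pow_le_pow_left₀ (by positivity) hs 2
      rwa [mul_pow, mul_pow, mul_pow, Real.sq_sqrt hx, Real.sq_sqrt (by norm_num),
        Real.sq_sqrt hk.le, sq_abs] at this
    have h6 : normLag (a + 1 + 1) k x ^ 2 * ((k + 1) * x) ≤ 5 * (a + 1) ^ 2 := by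
      rw [normLag, normC_succ, mul_pow, inv_pow, mul_assoc, inv_mul_le_iff₀ (by positivity)]
      have := pow_le_pow_left₀ (by positivity) hb 2
      nlinarith
    have h7 : normLag (a + 1 + 1) k x ^ 2 ≤ 4 := by
      rw [← sq_abs]; nlinarith [abs_nonneg (normLag (a + 1 + 1) k x)]
    have h8 : 0 ≤ normLag (a + 1 + 1) k x ^ 2 * ((k + 1) * x) := by positivity
    push_cast
    have e : normLag (a + 1 + 1) k x ^ 4 * ((k + 1) * x) =
      normLag (a + 1 + 1) k x ^ 2 * (normLag (a + 1 + 1) k x ^ 2 * ((k + 1) * x)) := by ring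
    rw [e]
    have : (0 : ℝ) ≤ a := by positivity
    nlinarith

/-- The normalized Bessel function `(m-1)! 2^{m-1} J_{m-1}(s) / s^{m-1}`. -/
def normBes (m : ℕ) (s : ℝ) : ℝ :=
  (Nat.factorial (m - 1) * 2 ^ (m - 1) : ℝ) * besselKer m s

lemma tendsto_descFactorial_div_pow (j : ℕ) :
    Tendsto (fun k : ℕ => (k.descFactorial j : ℝ) / (k + 1) ^ j) atTop (nhds 1) := by
  have h1 : Tendsto (fun k : ℕ => (k.descFactorial j : ℝ) / k ^ j) atTop (nhds 1) := by
    refine (Asymptotics.isEquivalent_iff_tendsto_one ?_).1 (isEquivalent_descFactorial j)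
    filter_upwards [eventually_gt_atTop 0] with k hk
    positivity
  have h2 := (tendsto_natCast_div_add_atTop (1 : ℝ)).pow j
  have h := h1.mul h2
  rw [one_pow, mul_one] at h
  refine h.congr' ?_
  filter_upwards [eventually_gt_atTop 0] with k hk
  have : (k : ℝ) ≠ 0 := by positivity
  rw [div_pow]
  field_simp

lemma normC_mul_lagPoly (a k : ℕ) (y : ℝ) :
    normC (a + 1) k * lagPoly (a + 1) k (y / (k + 1)) =
      ∑' j : ℕ, (a.factorial : ℝ) / ((a + j).factorial * j.factorial) *
        ((k.descFactorial j : ℝ) / (k + 1) ^ j) * (-y) ^ j := by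
  rw [tsum_eq_sum (s := Finset.range (k + 1)) (fun j hj => by
    have : k < j := by simpa using hj
    simp [Nat.descFactorial_of_lt this]), lagPoly, Finset.mul_sum]
  refine Finset.sum_congr rfl fun j hj => ?_
  have hj' : j ≤ k := by simpa [Nat.lt_succ_iff] using hj
  obtain ⟨i, rfl⟩ := Nat.exists_eq_add_of_le hj'
  have hd : ((i.factorial : ℝ)) * (j + i).descFactorial j = (j + i).factorial := by
    have := Nat.factorial_mul_descFactorial hj'
    rw [show j + i - j = i by omega] at this
    exact_mod_cast this
  rw [normC, show j + i + (a + 1) - 1 = i + (a + j) by omega, show j + i - j = i by omega,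
    Nat.cast_add_choose ℝ, Nat.add_sub_cancel, ← hd, neg_div', div_pow]
  have h1 : (i.factorial : ℝ) ≠ 0 := by positivity
  have h2 : ((i + (a + j)).factorial : ℝ) ≠ 0 := by positivity
  field_simp

lemma normBes_succ (a : ℕ) (s : ℝ) :
    normBes (a + 1) s =
      ∑' j : ℕ, (a.factorial : ℝ) / ((a + j).factorial * j.factorial) * (-(s ^ 2 / 4)) ^ j := by
  rw [normBes, besselKer, ← tsum_mul_left]
  refine tsum_congr fun j => ?_
  rw [Nat.add_sub_cancel, show j + (a + 1) - 1 = a + j by omega,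
    show 2 * j + (a + 1) - 1 = 2 * j + a by omega, pow_add, pow_mul, pow_mul,
    neg_pow (s ^ 2 / 4), div_pow]
  norm_num
  field_simp

/-- Mehler–Heine asymptotics for Laguerre functions. -/
lemma tendsto_normLag_normBes {m : ℕ} (hm : 1 ≤ m) (s : ℝ) :
    Tendsto (fun k : ℕ => normLag m k (s ^ 2 / 4 / (k + 1))) atTop (nhds (normBes m s)) := by
  obtain ⟨a, rfl⟩ := Nat.exists_eq_add_of_le' hm
  have h1 : Tendsto (fun k : ℕ => ∑' j : ℕ, (a.factorial : ℝ) / ((a + j).factorial * j.factorial) *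
        ((k.descFactorial j : ℝ) / (k + 1) ^ j) * (-(s ^ 2 / 4)) ^ j) atTop
      (nhds (∑' j : ℕ, (a.factorial : ℝ) / ((a + j).factorial * j.factorial) *
        (-(s ^ 2 / 4)) ^ j)) := by
    refine tendsto_tsum_of_dominated_convergence
      (Real.summable_pow_div_factorial (s ^ 2 / 4)) (fun j => ?_) (.of_forall fun k j => ?_)
    · simpa using ((tendsto_descFactorial_div_pow j).const_mul
        ((a.factorial : ℝ) / ((a + j).factorial * j.factorial))).mul_const ((-(s ^ 2 / 4)) ^ j)
    · have hd : (k.descFactorial j : ℝ) / (k + 1) ^ j ≤ 1 := by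
        rw [div_le_one (by positivity)]
        calc (k.descFactorial j : ℝ) ≤ (k : ℝ) ^ j := by exact_mod_cast Nat.descFactorial_le_pow k j
          _ ≤ (k + 1) ^ j := by gcongr; linarith
      have ha : (a.factorial : ℝ) ≤ (a + j).factorial := by
        exact_mod_cast Nat.factorial_le (by omega)
      have hc : (a.factorial : ℝ) / ((a + j).factorial * j.factorial) ≤ 1 / j.factorial := by
        rw [div_le_div_iff₀ (by positivity) (by positivity), one_mul]
        gcongr
      rw [norm_mul, norm_pow, norm_neg, Real.norm_of_nonneg (by positivity : (0 : ℝ) ≤ s ^ 2 / 4),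
        Real.norm_of_nonneg (by positivity)]
      calc _ ≤ 1 / (j.factorial : ℝ) * 1 * (s ^ 2 / 4) ^ j := by gcongr
        _ = _ := by ring
  have h2 : Tendsto (fun k : ℕ => Real.exp (-(s ^ 2 / 4 / (k + 1) / 2))) atTop (nhds 1) := by
    have h0 : Tendsto (fun k : ℕ => s ^ 2 / 4 / ((k : ℝ) + 1)) atTop (nhds 0) :=
      tendsto_const_nhds.div_atTop
        (tendsto_atTop_add_const_right _ _ tendsto_natCast_atTop_atTop)
    simpa [Function.comp_def] using (Real.continuous_exp.tendsto _).comp (h0.div_const 2).neg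
  have h := h1.mul h2
  rw [mul_one, ← normBes_succ] at h
  refine h.congr fun k => ?_
  rw [← normC_mul_lagPoly, normLag, lagExp, mul_assoc]

lemma abs_normBes_le {m : ℕ} (hm : 1 ≤ m) (s : ℝ) : |normBes m s| ≤ 2 :=
  le_of_tendsto (tendsto_normLag_normBes hm s).abs
    (.of_forall fun k => abs_normLag_le hm k (by positivity))

lemma normBes_pow_four_mul_le {m : ℕ} (hm : 1 ≤ m) (s : ℝ) :
    normBes m s ^ 4 * (s ^ 2 / 4) ≤ 10000 * m ^ 2 := by
  refine le_of_tendsto (((tendsto_normLag_normBes hm s).pow 4).mul_const (s ^ 2 / 4)) ?_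
  filter_upwards [tendsto_natCast_atTop_atTop.eventually_ge_atTop (s ^ 2 / 4)] with k hk
  have h := normLag_pow_four_mul_le hm k (x := s ^ 2 / 4 / (k + 1)) (by positivity) (by
    rw [div_le_iff₀ (by positivity)]
    nlinarith)
  rwa [mul_div_cancel₀ _ (by positivity : (k + 1 : ℝ) ≠ 0)] at h

lemma measurable_normBes {m : ℕ} (hm : 1 ≤ m) : Measurable (normBes m) := by
  refine measurable_of_tendsto_metrizable (f := fun (k : ℕ) s => normLag m k (s ^ 2 / 4 / (k + 1)))
    (fun k => ?_) (tendsto_pi_nhds.2 fun s => tendsto_normLag_normBes hm s)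
  exact (continuous_const.mul ((continuous_lagExp m k).comp (by fun_prop))).measurable

/-- The spherical kernel attached to a point of the Heisenberg fan. -/
def fanKer (n : ℕ) (a : ℝ × ℝ) (w : Cn n) : ℝ :=
  if a.1 = 0 then normBes n (√a.2 * ‖w‖) else normLag n (fanK n a) (|a.1| * ‖w‖ ^ 2 / 2)

lemma lagFun_eq_lagExp (m k : ℕ) (lam : ℝ) (w : Cn m) :
    lagFun m k lam w = lagExp m k (|lam| * ‖w‖ ^ 2 / 2) := by
  rw [lagFun, lagExp]
  ring_nf

lemma measurable_fanKer {n : ℕ} (hn : 1 ≤ n) (a : ℝ × ℝ) : Measurable (fanKer n a) := by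
  unfold fanKer
  split_ifs
  · exact (measurable_normBes hn).comp (measurable_norm.const_mul _)
  · exact (continuous_const.mul ((continuous_lagExp _ _).comp (by fun_prop))).measurable

lemma abs_fanKer_le {n : ℕ} (hn : 1 ≤ n) (a : ℝ × ℝ) (w : Cn n) : |fanKer n a w| ≤ 2 := by
  unfold fanKer
  split_ifs
  · exact abs_normBes_le hn _
  · exact abs_normLag_le hn _ (by positivity)

lemma fanK_spec {n : ℕ} {a : ℝ × ℝ} (ha : a ∈ fan n) (h0 : a.1 ≠ 0) :
    a.2 = (2 * fanK n a + n) * |a.1| := by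
  have h : ∃ k : ℕ, a.2 = (2 * k + n) * |a.1| := by
    rcases ha with ⟨k, -, hk⟩ | ⟨h, -⟩
    · exact ⟨k, hk⟩
    · exact absurd h h0
  rw [fanK, dif_pos h]
  exact h.choose_spec

lemma fan_abs_fst_le_snd {n : ℕ} (hn : 1 ≤ n) {a : ℝ × ℝ} (ha : a ∈ fan n) : |a.1| ≤ a.2 := by
  have hn' : (1 : ℝ) ≤ n := by exact_mod_cast hn
  rcases ha with ⟨k, -, hk⟩ | ⟨h, h'⟩
  · rw [hk]
    have : (0 : ℝ) ≤ k := by positivity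
    nlinarith [abs_nonneg a.1]
  · simpa [h] using h'

lemma fanKer_pow_four_mul_le {n : ℕ} (hn : 1 ≤ n) {a : ℝ × ℝ} (ha : a ∈ fan n) {M : ℝ}
    (hM : |a.1| ≤ M) {w : Cn n} (hw : n * M ^ 2 * ‖w‖ ^ 2 ≤ a.2) :
    fanKer n a w ^ 4 * (a.2 * ‖w‖ ^ 2 / (4 * n)) ≤ 10000 * n ^ 2 := by
  have hn' : (1 : ℝ) ≤ n := by exact_mod_cast hn
  have ha2 : 0 ≤ a.2 := (abs_nonneg _).trans (fan_abs_fst_le_snd hn ha)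
  have hw2 : 0 ≤ ‖w‖ ^ 2 := by positivity
  unfold fanKer
  split_ifs with h0
  · refine le_trans ?_ (normBes_pow_four_mul_le hn (√a.2 * ‖w‖))
    rw [mul_pow _ _ 2, Real.sq_sqrt ha2]
    gcongr
    linarith
  · have hk := fanK_spec ha h0
    set k := fanK n a
    have hpos : 0 < |a.1| := abs_pos.2 h0
    have hkn : (2 * k + n : ℝ) ≤ 2 * n * (k + 1) := by
      have : (0 : ℝ) ≤ k := by positivity
      nlinarith
    refine le_trans ?_ (normLag_pow_four_mul_le hn k (x := |a.1| * ‖w‖ ^ 2 / 2) (by positivity) ?_)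
    · refine mul_le_mul_of_nonneg_left ?_ (by positivity)
      rw [div_le_iff₀ (by positivity), hk]
      nlinarith [mul_le_mul_of_nonneg_right hkn (mul_nonneg hpos.le hw2)]
    · have h1 : n * (|a.1| * ‖w‖ ^ 2) * |a.1| ≤ (2 * n * (k + 1)) * |a.1| := by
        calc n * (|a.1| * ‖w‖ ^ 2) * |a.1| = n * |a.1| ^ 2 * ‖w‖ ^ 2 := by ring
          _ ≤ n * M ^ 2 * ‖w‖ ^ 2 := by gcongr
          _ ≤ (2 * k + n) * |a.1| := hk ▸ hw
          _ ≤ _ := by gcongr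
      have h2 := le_of_mul_le_mul_right h1 hpos
      have h3 : n * (|a.1| * ‖w‖ ^ 2) ≤ n * (2 * (k + 1)) := by linarith
      have := le_of_mul_le_mul_left h3 (by positivity)
      linarith

lemma tendsto_fanKer {n : ℕ} (hn : 1 ≤ n) (M : ℝ) {w : Cn n} (hw : w ≠ 0) :
    Tendsto (fun a => |fanKer n a w|)
      (comap Prod.snd atTop ⊓ 𝓟 {a | a ∈ fan n ∧ |a.1| ≤ M}) (nhds 0) := by
  have hn' : (0 : ℝ) < n := by exact_mod_cast hn
  have hw' : 0 < ‖w‖ ^ 2 := by positivity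
  rw [Metric.tendsto_nhds]
  intro δ hδ
  have hs : Tendsto (fun a : ℝ × ℝ => a.2)
      (comap Prod.snd atTop ⊓ 𝓟 {a | a ∈ fan n ∧ |a.1| ≤ M}) atTop :=
    tendsto_comap.mono_left inf_le_left
  have hmem : ∀ᶠ a in comap Prod.snd atTop ⊓ 𝓟 {a | a ∈ fan n ∧ |a.1| ≤ M},
      a ∈ fan n ∧ |a.1| ≤ M := mem_inf_of_right (mem_principal_self _)
  have ht : Tendsto (fun a : ℝ × ℝ => δ ^ 4 * (a.2 * ‖w‖ ^ 2 / (4 * n)))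
      (comap Prod.snd atTop ⊓ 𝓟 {a | a ∈ fan n ∧ |a.1| ≤ M}) atTop :=
    (((hs.atTop_mul_const hw').atTop_div_const (by positivity)).const_mul_atTop (by positivity))
  filter_upwards [hmem, hs.eventually_ge_atTop (n * M ^ 2 * ‖w‖ ^ 2), hs.eventually_gt_atTop 0,
    ht.eventually_gt_atTop (10000 * n ^ 2)] with a ha1 ha2 ha3 ha4
  have h := (fanKer_pow_four_mul_le hn ha1.1 ha1.2 ha2).trans_lt ha4
  have h' : |fanKer n a w| ^ 4 < δ ^ 4 := by
    rw [pow_abs, abs_of_nonneg (by positivity)]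
    exact lt_of_mul_lt_mul_right h (by positivity)
  simpa using lt_of_pow_lt_pow_left₀ 4 hδ.le h'

lemma norm_striNorm_le (n : ℕ) (f : Hn n → ℂ) (z : Cn n) (a : ℝ × ℝ) :
    ‖striNorm n f z a‖ ≤ ∫ w : Cn n, ‖fLam n f (-a.1) (z - w)‖ * |fanKer n a w| := by
  unfold striNorm fanKer
  split_ifs with h0
  · rw [striLim, ← integral_const_mul]
    refine (norm_integral_le_integral_norm _).trans_eq (integral_congr_ae (.of_forall fun w => ?_))
    simp only [h0, neg_zero, normBes, norm_mul, Complex.norm_real, Real.norm_eq_abs, abs_mul]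
    ring
  · rw [stri, twConv, ← integral_const_mul]
    refine (norm_integral_le_integral_norm _).trans_eq (integral_congr_ae (.of_forall fun w => ?_))
    have he : ‖Complex.exp (Complex.I / 2 * ((-a.1 : ℝ) : ℂ) * ((imZW z w : ℝ) : ℂ))‖ = 1 := by
      rw [show Complex.I / 2 * ((-a.1 : ℝ) : ℂ) * ((imZW z w : ℝ) : ℂ) =
        ((-a.1 / 2 * imZW z w : ℝ) : ℂ) * Complex.I by push_cast; ring]
      exact Complex.norm_exp_ofReal_mul_I _
    simp only [norm_mul, he, Complex.norm_real, Real.norm_eq_abs, normLag, abs_mul,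
      lagFun_eq_lagExp]
    ring

lemma norm_exp_I_mul (lam t : ℝ) : ‖Complex.exp (Complex.I * (lam : ℂ) * (t : ℂ))‖ = 1 := by
  rw [show Complex.I * (lam : ℂ) * (t : ℂ) = ((lam * t : ℝ) : ℂ) * Complex.I by push_cast; ring]
  exact Complex.norm_exp_ofReal_mul_I _

lemma norm_fLam_le (n : ℕ) (f : Hn n → ℂ) (lam : ℝ) (w : Cn n) :
    ‖fLam n f lam w‖ ≤ ∫ t : ℝ, ‖f (w, t)‖ := by
  refine (norm_integral_le_integral_norm _).trans_eq (integral_congr_ae (.of_forall fun t => ?_))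
  simp only [norm_mul, norm_exp_I_mul, one_mul]

lemma integrable_fLam {n : ℕ} {f : Hn n → ℂ} (hf : Integrable f) (lam : ℝ) :
    Integrable (fLam n f lam) := by
  have h : Integrable
      (fun x : Hn n => Complex.exp (Complex.I * (lam : ℂ) * (x.2 : ℂ)) * f x) := by
    refine hf.bdd_mul (c := 1) ?_ (.of_forall fun x => (norm_exp_I_mul lam x.2).le)
    exact (by fun_prop : Continuous fun x : Hn n =>
      Complex.exp (Complex.I * (lam : ℂ) * (x.2 : ℂ))).aestronglyMeasurable
  exact Integrable.integral_prod_left h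

lemma tendsto_fLam_neg_cocompact (n : ℕ) (f : Hn n → ℂ) (w : Cn n) :
    Tendsto (fun lam : ℝ => fLam n f (-lam) w) (cocompact ℝ) (nhds 0) := by
  have hc : (2 * π)⁻¹ ≠ 0 := by positivity
  have h := (Real.tendsto_integral_exp_smul_cocompact fun t : ℝ => f (w, t)).comp
    (Homeomorph.mulRight₀ _ hc).isClosedEmbedding.tendsto_cocompact
  refine h.congr fun lam => integral_congr_ae (.of_forall fun t => ?_)
  simp only [Homeomorph.coe_mulRight₀, Circle.smul_def, Real.fourierChar_apply, smul_eq_mul]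
  congr 2
  push_cast
  have : (π : ℂ) ≠ 0 := by exact_mod_cast Real.pi_ne_zero
  field_simp

lemma integrable_integral_norm {n : ℕ} {f : Hn n → ℂ} (hf : Integrable f) (z : Cn n) :
    Integrable (fun w : Cn n => ∫ t : ℝ, ‖f (z - w, t)‖) :=
  (Integrable.integral_prod_left hf.norm).comp_sub_left z

lemma tendsto_integral_norm_fLam {n : ℕ} {f : Hn n → ℂ} (hf : Integrable f) (z : Cn n) :
    Tendsto (fun lam : ℝ => ∫ w : Cn n, ‖fLam n f (-lam) (z - w)‖) (cocompact ℝ) (nhds 0) := by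
  have : (cocompact ℝ).IsCountablyGenerated := by
    rw [← Metric.cobounded_eq_cocompact, ← comap_norm_atTop]
    infer_instance
  rw [← integral_zero (Cn n) ℝ (μ := volume)]
  refine tendsto_integral_filter_of_dominated_convergence
    (fun w => ∫ t : ℝ, ‖f (z - w, t)‖)
    (.of_forall fun lam => ((integrable_fLam hf _).comp_sub_left z).norm.aestronglyMeasurable)
    (.of_forall fun lam => .of_forall fun w => ?_) (integrable_integral_norm hf z)
    (.of_forall fun w => ?_)
  · rw [norm_norm]
    exact norm_fLam_le n f _ _
  · simpa using (tendsto_fLam_neg_cocompact n f (z - w)).norm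

lemma tendsto_striNorm_of_abs_fst_le {n : ℕ} (hn : 1 ≤ n) {f : Hn n → ℂ} (hf : Integrable f)
    (z : Cn n) (M : ℝ) :
    Tendsto (fun a => ‖striNorm n f z a‖)
      (comap Prod.snd atTop ⊓ 𝓟 {a | a ∈ fan n ∧ |a.1| ≤ M}) (nhds 0) := by
  refine squeeze_zero (fun _ => norm_nonneg _) (norm_striNorm_le n f z) ?_
  rw [← integral_zero (Cn n) ℝ (μ := volume)]
  have : Nontrivial (Cn n) := by
    have : Nonempty (Fin n) := ⟨⟨0, hn⟩⟩
    infer_instance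
  refine tendsto_integral_filter_of_dominated_convergence
    (fun w => (∫ t : ℝ, ‖f (z - w, t)‖) * 2)
    (.of_forall fun a => ((integrable_fLam hf _).comp_sub_left z).norm.aestronglyMeasurable.mul
      (measurable_fanKer hn a).abs.aestronglyMeasurable)
    (.of_forall fun a => .of_forall fun w => ?_) ((integrable_integral_norm hf z).mul_const 2) ?_
  · rw [norm_mul, norm_norm, Real.norm_eq_abs, abs_abs]
    exact mul_le_mul (norm_fLam_le n f _ _) (abs_fanKer_le hn a w) (abs_nonneg _)
      (integral_nonneg fun _ => norm_nonneg _)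
  · have hne : ∀ᵐ w : Cn n, w ≠ 0 := by
      simp [ae_iff]
    filter_upwards [hne] with w hw
    have h := (tendsto_fanKer hn M hw).const_mul (∫ t : ℝ, ‖f (z - w, t)‖)
    rw [mul_zero] at h
    exact squeeze_zero (fun _ => by positivity)
      (fun a => mul_le_mul_of_nonneg_right (norm_fLam_le n f _ _) (abs_nonneg _)) h

/-- **Riemann–Lebesgue lemma, vanishing part.**
For every f ∈ L¹(ℍⁿ) and every fixed z ∈ ℂⁿ, the normalized Strichartz Fourier transform
vanishes at infinity on the Heisenberg fan. -/
theorem strichartz_vanishes_at_infinity (n : ℕ) (hn : 1 ≤ n)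
    (f : Hn n → ℂ) (hf : Integrable f (volume : Measure (Hn n))) (z : Cn n) :
    ∀ ε : ℝ, 0 < ε → ∃ R : ℝ, 0 < R ∧ ∀ a ∈ fan n,
      R < Real.sqrt (a.1 ^ 2 + a.2 ^ 2) → ‖striNorm n f z a‖ < ε := by
  intro ε hε
  obtain ⟨M, hM⟩ : ∃ M : ℝ, ∀ lam : ℝ, M < |lam| →
      ∫ w : Cn n, ‖fLam n f (-lam) (z - w)‖ < ε / 2 := by
    have h := (tendsto_integral_norm_fLam hf z).eventually_lt_const (half_pos hε)
    rw [← Metric.cobounded_eq_cocompact, ← comap_norm_atTop] at h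
    obtain ⟨M, hM⟩ := (eventually_atTop.1 (eventually_comap.1 h))
    exact ⟨M, fun lam hlam => hM _ hlam.le lam rfl⟩
  obtain ⟨T, hT⟩ : ∃ T : ℝ, ∀ a ∈ fan n, |a.1| ≤ M → T ≤ a.2 → ‖striNorm n f z a‖ < ε := by
    have h := (tendsto_striNorm_of_abs_fst_le hn hf z M).eventually_lt_const hε
    rw [eventually_inf_principal] at h
    obtain ⟨T, hT⟩ := (eventually_atTop.1 (eventually_comap.1 h))
    exact ⟨T, fun a ha haM haT => hT _ haT a rfl ⟨ha, haM⟩⟩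
  refine ⟨max 1 (2 * T), by positivity, fun a ha hR => ?_⟩
  have h12 := fan_abs_fst_le_snd hn ha
  by_cases haM : |a.1| ≤ M
  · refine hT a ha haM ?_
    have h1 : √(a.1 ^ 2 + a.2 ^ 2) ≤ 2 * a.2 := by
      rw [Real.sqrt_le_left (by linarith [abs_nonneg a.1]), ← sq_abs a.1]
      nlinarith [abs_nonneg a.1]
    linarith [le_max_right 1 (2 * T)]
  · have hg : Integrable (fun w : Cn n => ‖fLam n f (-a.1) (z - w)‖) :=
      ((integrable_fLam hf _).comp_sub_left z).norm
    calc ‖striNorm n f z a‖ ≤ ∫ w : Cn n, ‖fLam n f (-a.1) (z - w)‖ * |fanKer n a w| :=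
          norm_striNorm_le n f z a
      _ ≤ ∫ w : Cn n, ‖fLam n f (-a.1) (z - w)‖ * 2 :=
          integral_mono_of_nonneg (.of_forall fun w => by positivity) (hg.mul_const 2)
            (.of_forall fun w => mul_le_mul_of_nonneg_left (abs_fanKer_le hn a w) (norm_nonneg _))
      _ = (∫ w : Cn n, ‖fLam n f (-a.1) (z - w)‖) * 2 := integral_mul_const _ _
      _ < ε := by linarith [hM a.1 (not_le.1 haM)]
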